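/- There exist K₁, K₂ > 0 such that for every continuously differentiable ε : ℝ → ℝ with ε and ε' square integrable and satisfying ∫_ℝ ε(x)·Q'(x) dx = 0, one has ∫_ℝ ε'(x)² dx + ∫_ℝ ε(x)² dx − p·∫_ℝ Q(x)^(p−1)·ε(x)² dx ≥ K₁·(∫_ℝ ε(x)² dx + ∫_ℝ ε'(x)² dx) − K₂·(∫_ℝ ε(x)·Q(x)^((p+1)/2) dx)². -/

import Mathlib

open MeasureTheory

/-- The soliton profile `Q(x) = ((p+1)/(2 cosh²(((p−1)/2)x)))^(1/(p−1))`. -/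
noncomputable def Q (p : ℕ) (x : ℝ) : ℝ :=
  (((p : ℝ) + 1) / (2 * Real.cosh ((((p : ℝ) - 1) / 2) * x) ^ 2)) ^ (1 / ((p : ℝ) - 1))

/-- The derivative of a compactly supported `C¹` function has vanishing integral. -/
theorem integral_eq_zero_of_hasDerivAt_of_hasCompactSupport {P P' : ℝ → ℝ}
    (hP : HasCompactSupport P) (hd : ∀ x, HasDerivAt P (P' x) x) (hc : Continuous P') :
    ∫ x, P' x = 0 := by
  have hP' : HasCompactSupport P' := by
    have h : deriv P = P' := funext fun x => (hd x).deriv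
    exact h ▸ hP.deriv
  have hPc : Continuous P := continuous_iff_continuousAt.2 fun x => (hd x).continuousAt
  exact integral_eq_zero_of_hasDerivAt_of_integrable hd
    (hc.integrable_of_hasCompactSupport hP') (hPc.integrable_of_hasCompactSupport hP)

/-- Inversion of the first-order operator `u ↦ q u - u'` on compactly supported functions that are
orthogonal to the kernel `w` of its adjoint. -/
theorem exists_hasCompactSupport_hasDerivAt {w q f : ℝ → ℝ} (hw : ∀ x, 0 < w x)
    (hdw : ∀ x, HasDerivAt w (-(q x * w x)) x) (hf : Continuous f) (hfs : HasCompactSupport f)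
    (h0 : ∫ x, f x * w x = 0) :
    ∃ u : ℝ → ℝ, HasCompactSupport u ∧ ∀ x, HasDerivAt u (q x * u x - f x) x := by
  have hwc : Continuous w := continuous_iff_continuousAt.2 fun x => (hdw x).continuousAt
  have hfw : Continuous fun x => f x * w x := hf.mul hwc
  obtain ⟨R, hR⟩ := hfs.isCompact.isBounded.subset_closedBall 0
  have hz : ∀ x, R < |x| → f x = 0 := fun x hx => by
    by_contra hne
    have := hR (subset_tsupport f hne)
    rw [Metric.mem_closedBall, Real.dist_eq, sub_zero] at this
    linarith
  set S := |R| + 1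
  have hRS : R < S := by have := le_abs_self R; linarith
  have hS0 : 0 < S := by positivity
  refine ⟨fun x => -(∫ t in (-S)..x, f t * w t) / w x, ?_, fun x => ?_⟩
  · refine HasCompactSupport.intro (isCompact_Icc (a := -S) (b := S)) fun x hx => ?_
    have hi : ∫ t in (-S)..x, f t * w t = 0 := by
      rcases le_or_gt (-S) x with h | h
      · have hxS : S < x := by
          by_contra hc
          exact hx ⟨h, not_lt.1 hc⟩
        rw [intervalIntegral.integral_eq_integral_of_support_subset, h0]
        intro t ht
        have hft : f t ≠ 0 := fun h => ht (by simp [h])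
        have : |t| ≤ R := not_lt.1 fun h => hft (hz t h)
        have := abs_le.1 this
        exact ⟨by linarith, by linarith⟩
      · rw [intervalIntegral.integral_congr (g := fun _ => (0 : ℝ))]
        · simp
        · intro t ht
          rw [Set.uIcc_of_ge h.le] at ht
          have : f t = 0 := hz t (by
            rw [abs_of_nonpos (by linarith [ht.2])]
            linarith [ht.2])
          simp [this]
    simp [hi]
  · have hI : HasDerivAt (fun y => ∫ t in (-S)..y, f t * w t) (f x * w x) x :=
      intervalIntegral.integral_hasDerivAt_right (hfw.intervalIntegrable _ _)
        hfw.aestronglyMeasurable.stronglyMeasurableAtFilter hfw.continuousAt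
    refine (hI.fun_neg.fun_div (hdw x) (hw x).ne').congr_deriv ?_
    have := (hw x).ne'
    field_simp
    ring

/-- Two Darboux transformations give the spectral gap of `-∂² + 1 - (2 * a + 1)(a+1)(1-T²)` on
compactly supported functions orthogonal to the ground state `G` and to the kernel `T q`. -/
theorem integral_sq_le_of_orthogonal {a θ : ℝ} {T q G ε : ℝ → ℝ} (ha : 1 / 2 ≤ a)
    (hθ : a * (a + 2) = θ * (1 + 2 * (a * (a + 2))))
    (hT : ∀ x, HasDerivAt T (a * (1 - T x ^ 2)) x) (hT1 : ∀ x, T x ^ 2 ≤ 1)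
    (hq : ∀ x, 0 < q x) (hdq : ∀ x, HasDerivAt q (-(T x * q x)) x)
    (hG : ∀ x, 0 < G x) (hdG : ∀ x, HasDerivAt G (-((1 + a) * T x * G x)) x)
    (hε : ContDiff ℝ 1 ε) (hεs : HasCompactSupport ε)
    (h0 : ∫ x, ε x * G x = 0) (h1 : ∫ x, ε x * (T x * q x) = 0) :
    θ * ∫ x, ε x ^ 2 ≤
      ∫ x, (deriv ε x ^ 2 + (1 - (2 * a + 1) * (a + 1) * (1 - T x ^ 2)) * ε x ^ 2) := by
  have hdε : ∀ x, HasDerivAt ε (deriv ε x) x := fun x =>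
    (hε.differentiable one_ne_zero x).hasDerivAt
  have hεc : Continuous ε := hε.continuous
  have hε'c : Continuous (deriv ε) := hε.continuous_deriv le_rfl
  have hTc : Continuous T := continuous_iff_continuousAt.2 fun x => (hT x).continuousAt
  have hqc : Continuous q := continuous_iff_continuousAt.2 fun x => (hdq x).continuousAt
  obtain ⟨u, hus, hu⟩ := exists_hasCompactSupport_hasDerivAt hG hdG hεc hεs h0
  have huc : Continuous u := continuous_iff_continuousAt.2 fun x => (hu x).continuousAt
  have hεTq : Integrable fun x => ε x * (T x * q x) :=
    (hεc.mul (hTc.mul hqc)).integrable_of_hasCompactSupport hεs.mul_right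
  have huq : Integrable fun x => u x * q x :=
    (huc.mul hqc).integrable_of_hasCompactSupport hus.mul_right
  have huq0 : ∫ x, u x * q x = 0 := by
    have h := integral_eq_zero_of_hasDerivAt_of_hasCompactSupport
      (P := fun x => u x * (T x * q x)) (P' := fun x => a * (u x * q x) - ε x * (T x * q x))
      hus.mul_right
      (fun x => ((hu x).fun_mul ((hT x).fun_mul (hdq x))).congr_deriv (by ring)) (by fun_prop)
    rw [integral_sub (huq.const_mul a) hεTq, h1, integral_const_mul, sub_zero] at h
    exact (mul_eq_zero.1 h).resolve_left (by linarith)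
  obtain ⟨v, hvs, hv⟩ := exists_hasCompactSupport_hasDerivAt hq hdq huc hus huq0
  have hvc : Continuous v := continuous_iff_continuousAt.2 fun x => (hv x).continuousAt
  have hθ0 : 0 < θ := by
    have : 0 < a * (a + 2) := by nlinarith
    by_contra hc
    nlinarith
  have hsq : ∀ {f : ℝ → ℝ}, HasCompactSupport f → HasCompactSupport fun x => f x ^ 2 :=
    fun hf => hf.comp_left (g := fun y : ℝ => y ^ 2) (by simp)
  set S : ℝ → ℝ := fun x => (deriv ε x + (1 + a) * T x * ε x - a * (a + 2) * u x) ^ 2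
      + a * (a + 2) * θ * (2 * ((2 + a) * (T x * u x) - ε x - v x / 2) ^ 2
        + (T x * v x - u x) ^ 2 + (a * (1 - T x ^ 2) + T x ^ 2 - 1 / 2) * v x ^ 2) with hS
  have hS0 : ∀ x, 0 ≤ S x := fun x => by
    have : 0 ≤ a * (1 - T x ^ 2) + T x ^ 2 - 1 / 2 := by nlinarith [hT1 x, sq_nonneg (T x)]
    have : 0 ≤ a := by linarith
    positivity
  set P : ℝ → ℝ := fun x => u x * (-2 * (a * (a + 2)) * ((2 + a) * (T x * u x) - ε x)
      + (a * (a + 2) + θ) * (2 + a) * (T x * u x) + 2 * (a * (a + 2)) * θ * v x)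
      - (1 + a) * (T x * ε x ^ 2) - a * (a + 2) * θ * (T x * v x ^ 2) with hP
  have hPs : HasCompactSupport P :=
    (hus.mul_right.sub (hsq hεs).mul_left.mul_left).sub (hsq hvs).mul_left.mul_left
  set P' : ℝ → ℝ := fun x => deriv ε x ^ 2
      + (1 - (2 * a + 1) * (a + 1) * (1 - T x ^ 2)) * ε x ^ 2 - θ * ε x ^ 2 - S x with hP'
  have hPc : Continuous P' := by fun_prop
  have hPd : ∀ x, HasDerivAt P (P' x) x := fun x => by
    have hTu := (hT x).fun_mul (hu x)
    refine ((((hu x).fun_mul (((((hTu.const_mul (2 + a)).fun_sub (hdε x)).const_mul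
      (-2 * (a * (a + 2)))).fun_add (hTu.const_mul ((a * (a + 2) + θ) * (2 + a)))).fun_add
      ((hv x).const_mul (2 * (a * (a + 2)) * θ)))).fun_sub
      (((hT x).fun_mul ((hdε x).fun_pow 2)).const_mul (1 + a))).fun_sub
      (((hT x).fun_mul ((hv x).fun_pow 2)).const_mul (a * (a + 2) * θ))).congr_deriv ?_
    simp only [hP', hS]
    generalize deriv ε x = ε', T x = t, u x = y, v x = z, ε x = e
    linear_combination (-((2 + a) * t * y - e) ^ 2) * hθ
  have hint := integral_eq_zero_of_hasDerivAt_of_hasCompactSupport hPs hPd hPc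
  have hi1 : Integrable fun x => ε x ^ 2 :=
    (hεc.pow 2).integrable_of_hasCompactSupport (hsq hεs)
  have hi2 : Integrable fun x =>
      deriv ε x ^ 2 + (1 - (2 * a + 1) * (a + 1) * (1 - T x ^ 2)) * ε x ^ 2 :=
    Continuous.integrable_of_hasCompactSupport (by fun_prop)
      ((hsq hεs.deriv).add (hsq hεs).mul_left)
  have hP's : HasCompactSupport P' := by
    have h : deriv P = P' := funext fun x => (hPd x).deriv
    exact h ▸ hPs.deriv
  have hi3 : Integrable P' := hPc.integrable_of_hasCompactSupport hP's
  rw [← integral_const_mul, ← add_zero (∫ x, θ * ε x ^ 2), ← hint,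
    ← integral_add (hi1.const_mul θ) hi3]
  refine integral_mono ((hi1.const_mul θ).add hi3) hi2 fun x => ?_
  have := hS0 x
  simp only [hP']
  linarith

/-- The `H¹` version of the spectral gap. -/
theorem integral_sq_add_deriv_sq_le_of_orthogonal {a : ℝ} (ha : 1 / 2 ≤ a) :
    ∃ s : ℝ, 0 < s ∧ ∀ {T q G ε : ℝ → ℝ},
    (∀ x, HasDerivAt T (a * (1 - T x ^ 2)) x) → (∀ x, T x ^ 2 ≤ 1) →
    (∀ x, 0 < q x) → (∀ x, HasDerivAt q (-(T x * q x)) x) →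
    (∀ x, 0 < G x) → (∀ x, HasDerivAt G (-((1 + a) * T x * G x)) x) →
    ContDiff ℝ 1 ε → HasCompactSupport ε →
    (∫ x, ε x * G x = 0) → (∫ x, ε x * (T x * q x) = 0) →
    0 ≤ ∫ x, (deriv ε x ^ 2 + (1 - (2 * a + 1) * (a + 1) * (1 - T x ^ 2)) * ε x ^ 2
      - s * (deriv ε x ^ 2 + ε x ^ 2)) := by
  set θ := a * (a + 2) / (1 + 2 * (a * (a + 2))) with hθ
  set D := (2 * a + 1) * (a + 1)
  have hm : 0 < a * (a + 2) := by nlinarith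
  have hθ0 : 0 < θ := by positivity
  have hD0 : 0 < D := by
    have : 0 < a := by linarith
    positivity
  set s := θ / (D + θ)
  have hs0 : 0 < s := by positivity
  have hs1 : s * (D + θ) = θ := div_mul_cancel₀ _ (by positivity)
  have hs2 : s ≤ 1 := (div_le_one (by positivity)).2 (by linarith)
  refine ⟨s, hs0, ?_⟩
  intro T q G ε hT hT1 hq hdq hG hdG hε hεs h0 h1
  have key := integral_sq_le_of_orthogonal ha (θ := θ) (by rw [hθ]; field_simp) hT hT1 hq hdq hG
    hdG hε hεs h0 h1
  have hεc : Continuous ε := hε.continuous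
  have hε'c : Continuous (deriv ε) := hε.continuous_deriv le_rfl
  have hTc : Continuous T := continuous_iff_continuousAt.2 fun x => (hT x).continuousAt
  have hsq : ∀ {f : ℝ → ℝ}, HasCompactSupport f → HasCompactSupport fun x => f x ^ 2 :=
    fun hf => hf.comp_left (g := fun y : ℝ => y ^ 2) (by simp)
  have hi1 : Integrable fun x => ε x ^ 2 :=
    (hεc.pow 2).integrable_of_hasCompactSupport (hsq hεs)
  have hi2 : Integrable fun x => deriv ε x ^ 2 + (1 - D * (1 - T x ^ 2)) * ε x ^ 2 :=
    Continuous.integrable_of_hasCompactSupport (by fun_prop)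
      ((hsq hεs.deriv).add (hsq hεs).mul_left)
  have hi3 : Integrable fun x => deriv ε x ^ 2 :=
    (hε'c.pow 2).integrable_of_hasCompactSupport (hsq hεs.deriv)
  calc 0 ≤ (1 - s) * ((∫ x, (deriv ε x ^ 2 + (1 - D * (1 - T x ^ 2)) * ε x ^ 2))
        - θ * ∫ x, ε x ^ 2) := mul_nonneg (by linarith) (by linarith)
    _ = ∫ x, (1 - s) * (deriv ε x ^ 2 + (1 - D * (1 - T x ^ 2)) * ε x ^ 2 - θ * ε x ^ 2) := by
      rw [integral_const_mul, integral_sub hi2 (hi1.const_mul θ), integral_const_mul]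
    _ ≤ _ := by
      refine integral_mono ((hi2.sub (hi1.const_mul θ)).const_mul (1 - s))
        (hi2.sub ((hi3.add hi1).const_mul s)) fun x => ?_
      have : 0 ≤ s * D * (T x ^ 2 * ε x ^ 2) := by positivity
      beta_reduce
      nlinarith [this, congrArg (· * ε x ^ 2) hs1]

theorem perturbed_square_nonneg {s k M C : ℝ} (x b : ℝ) (hs : 0 < s) (hk : |k| ≤ M)
    (hC : M + 2 * M ^ 2 / s ≤ C) :
    0 ≤ 3 * s / 4 * x ^ 2 + 2 * k * x * b + (k + C) * b ^ 2 := by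
  have h1 : 0 ≤ s / 2 * (x + 2 * k * b / s) ^ 2 := by positivity
  have h2 : s / 2 * (x + 2 * k * b / s) ^ 2
      = s / 2 * x ^ 2 + 2 * k * x * b + 2 * k ^ 2 / s * b ^ 2 := by
    field_simp
    ring
  have h3 : k ^ 2 ≤ M ^ 2 := sq_le_sq' (abs_le.1 hk).1 (abs_le.1 hk).2
  have h4 : 2 * k ^ 2 / s ≤ 2 * M ^ 2 / s := by gcongr
  have h5 : 0 ≤ (k + C - 2 * k ^ 2 / s) * b ^ 2 :=
    mul_nonneg (by linarith [(abs_le.1 hk).1]) (sq_nonneg b)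
  nlinarith [mul_nonneg hs.le (sq_nonneg x)]

/-- Coercivity on compactly supported functions, up to the components along the ground state
and along the kernel. -/
theorem exists_coercive_of_hasCompactSupport {a : ℝ} {T q G : ℝ → ℝ} (ha : 1 / 2 ≤ a)
    (hT : ∀ x, HasDerivAt T (a * (1 - T x ^ 2)) x) (hT1 : ∀ x, T x ^ 2 ≤ 1)
    (hq : ∀ x, 0 < q x) (hdq : ∀ x, HasDerivAt q (-(T x * q x)) x)
    (hG : ∀ x, 0 < G x) (hdG : ∀ x, HasDerivAt G (-((1 + a) * T x * G x)) x)
    (hTo : ∀ x, T (-x) = -T x) (hqe : ∀ x, q (-x) = q x) (hGe : ∀ x, G (-x) = G x)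
    (hT0 : T 1 ≠ 0) :
    ∃ K C : ℝ, 0 < K ∧ 0 < C ∧ ∀ ε : ℝ → ℝ, ContDiff ℝ 1 ε → HasCompactSupport ε →
      K * (∫ x, (deriv ε x ^ 2 + ε x ^ 2))
          - C * ((∫ x, ε x * G x) ^ 2 + (∫ x, ε x * (T x * q x)) ^ 2) ≤
        ∫ x, (deriv ε x ^ 2 + (1 - (2 * a + 1) * (a + 1) * (1 - T x ^ 2)) * ε x ^ 2) := by
  obtain ⟨s, hs, H⟩ := integral_sq_add_deriv_sq_le_of_orthogonal ha
  set D := (2 * a + 1) * (a + 1)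
  have hD0 : 0 < D := by
    have : 0 < a := by linarith
    positivity
  have hTc : Continuous T := continuous_iff_continuousAt.2 fun x => (hT x).continuousAt
  have hqc : Continuous q := continuous_iff_continuousAt.2 fun x => (hdq x).continuousAt
  have hGc : Continuous G := continuous_iff_continuousAt.2 fun x => (hdG x).continuousAt
  have hTC : ContDiff ℝ 1 T := by
    refine contDiff_one_iff_deriv.2 ⟨fun x => (hT x).differentiableAt, ?_⟩
    rw [funext fun x => (hT x).deriv]
    fun_prop
  have hsq : ∀ {f : ℝ → ℝ}, HasCompactSupport f → HasCompactSupport fun x => f x ^ 2 :=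
    fun hf => hf.comp_left (g := fun y : ℝ => y ^ 2) (by simp)
  have hint : ∀ {f : ℝ → ℝ}, ContDiff ℝ 1 f → HasCompactSupport f →
      Integrable fun x => deriv f x ^ 2 + f x ^ 2 := fun {f} hf hfs =>
    Continuous.integrable_of_hasCompactSupport
      (((hf.continuous_deriv le_rfl).pow 2).add (hf.continuous.pow 2))
      ((hsq hfs.deriv).add (hsq hfs))
  let B : ContDiffBump (0 : ℝ) := ⟨1, 2, one_pos, one_lt_two⟩
  set χ : ℝ → ℝ := ⇑B
  have hχC : ContDiff ℝ 1 χ := B.contDiff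
  have hχc : Continuous χ := hχC.continuous
  have hχs : HasCompactSupport χ := B.hasCompactSupport
  have hχe : ∀ x, χ (-x) = χ x := B.neg
  have hχ0 : ∀ x, 0 ≤ χ x := fun x => B.nonneg
  have hχ1 : χ 1 = 1 := B.one_of_mem_closedBall (by simp [B])
  set ψ : ℝ → ℝ := fun x => χ x * T x with hψ
  have hψC : ContDiff ℝ 1 ψ := hχC.mul hTC
  have hψc : Continuous ψ := hψC.continuous
  have hψs : HasCompactSupport ψ := hχs.mul_right
  have hodd : ∀ f : ℝ → ℝ, (∀ x, f (-x) = -f x) → ∫ x, f x = 0 := fun f hf => by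
    have h := integral_neg_eq_self f volume
    simp only [hf, integral_neg] at h
    linarith
  have hχψ : ∫ x, χ x * (T x * q x) = 0 := hodd _ fun x => by rw [hχe, hTo, hqe]; ring
  have hψG : ∫ x, ψ x * G x = 0 := hodd _ fun x => by simp only [hψ]; rw [hχe, hTo, hGe]; ring
  set α := ∫ x, χ x * G x with hα
  set β := ∫ x, ψ x * (T x * q x) with hβ
  have hα0 : 0 < α := Continuous.integral_pos_of_hasCompactSupport_nonneg_nonzero (x := 1)
    (hχc.mul hGc) hχs.mul_right (fun x => mul_nonneg (hχ0 x) (hG x).le)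
    (by simp [hχ1, (hG 1).ne'])
  have hβ0 : 0 < β := Continuous.integral_pos_of_hasCompactSupport_nonneg_nonzero (x := 1)
    (hψc.mul (hTc.mul hqc)) hψs.mul_right
    (fun x => by
      have e : ψ x * (T x * q x) = χ x * T x ^ 2 * q x := by simp only [hψ]; ring
      exact (mul_nonneg (mul_nonneg (hχ0 x) (sq_nonneg _)) (hq x).le).trans_eq e.symm)
    (by simp [hψ, hχ1, (hq 1).ne', hT0])
  set M := 1 + D + s
  set C₀ := M + 2 * M ^ 2 / s
  have hC₀0 : 0 < C₀ := by positivity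
  set A₀ := ∫ x, (deriv χ x ^ 2 + χ x ^ 2) with hA₀
  set A₁ := ∫ x, (deriv ψ x ^ 2 + ψ x ^ 2) with hA₁
  have hA₀0 : 0 ≤ A₀ := integral_nonneg fun x => by positivity
  have hA₁0 : 0 ≤ A₁ := integral_nonneg fun x => by positivity
  refine ⟨s / 4, 2 * C₀ * (A₀ / α ^ 2 + A₁ / β ^ 2) + 1, by positivity, by positivity, ?_⟩
  intro ε hε hεs
  have hεc : Continuous ε := hε.continuous
  have hε'c : Continuous (deriv ε) := hε.continuous_deriv le_rfl
  set e₀ := ∫ x, ε x * G x with he₀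
  set e₁ := ∫ x, ε x * (T x * q x) with he₁
  set c₀ := e₀ / α with hc₀
  set c₁ := e₁ / β with hc₁
  set η : ℝ → ℝ := fun x => ε x - c₀ * χ x - c₁ * ψ x with hη
  have hηC : ContDiff ℝ 1 η := (hε.sub (contDiff_const.mul hχC)).sub (contDiff_const.mul hψC)
  have hηs : HasCompactSupport η := (hεs.sub hχs.mul_left).sub hψs.mul_left
  have hηd : ∀ x, deriv η x = deriv ε x - c₀ * deriv χ x - c₁ * deriv ψ x := fun x =>
    ((((hε.differentiable one_ne_zero x).hasDerivAt).fun_sub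
      ((hχC.differentiable one_ne_zero x).hasDerivAt.const_mul c₀)).fun_sub
      ((hψC.differentiable one_ne_zero x).hasDerivAt.const_mul c₁)).deriv
  have hlin : ∀ g : ℝ → ℝ, Continuous g → ∫ x, η x * g x
      = (∫ x, ε x * g x) - c₀ * (∫ x, χ x * g x) - c₁ * ∫ x, ψ x * g x := fun g hg => by
    have i1 : Integrable fun x => ε x * g x :=
      (hεc.mul hg).integrable_of_hasCompactSupport hεs.mul_right
    have i2 : Integrable fun x => χ x * g x :=
      (hχc.mul hg).integrable_of_hasCompactSupport hχs.mul_right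
    have i3 : Integrable fun x => ψ x * g x :=
      (hψc.mul hg).integrable_of_hasCompactSupport hψs.mul_right
    have i4 : Integrable fun x => ε x * g x - c₀ * (χ x * g x) := i1.sub (i2.const_mul c₀)
    rw [← integral_const_mul, ← integral_const_mul, ← integral_sub i1 (i2.const_mul c₀),
      ← integral_sub i4 (i3.const_mul c₁)]
    congr 1 with x
    simp only [hη]
    ring
  have horth := H hT hT1 hq hdq hG hdG hηC hηs
    (by rw [hlin G hGc, hψG, ← hα, ← he₀, hc₀]; field_simp; ring)
    (by rw [hlin (fun x => T x * q x) (hTc.mul hqc), hχψ, ← hβ, ← he₁, hc₁]; field_simp; ring)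
  have hi0 : Integrable fun x => deriv ε x ^ 2 + (1 - D * (1 - T x ^ 2)) * ε x ^ 2 :=
    Continuous.integrable_of_hasCompactSupport (by fun_prop)
      ((hsq hεs.deriv).add (hsq hεs).mul_left)
  have hη'c : Continuous (deriv η) := hηC.continuous_deriv le_rfl
  have hηc : Continuous η := hηC.continuous
  have hi1 : Integrable fun x => deriv η x ^ 2 + (1 - D * (1 - T x ^ 2)) * η x ^ 2
      - s * (deriv η x ^ 2 + η x ^ 2) :=
    Continuous.integrable_of_hasCompactSupport (by fun_prop)
      (((hsq hηs.deriv).add (hsq hηs).mul_left).sub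
        (((hsq hηs.deriv).add (hsq hηs)).mul_left))
  have hiε := hint hε hεs
  have hiχ := hint hχC hχs
  have hiψ := hint hψC hψs
  have hmono := integral_mono hi1
    (((hi0.sub (hiε.const_mul (s / 4))).add (hiχ.const_mul (2 * C₀ * c₀ ^ 2))).add
      (hiψ.const_mul (2 * C₀ * c₁ ^ 2))) fun x => by
    simp only [Pi.add_apply, Pi.sub_apply]
    have hx : η x = ε x - c₀ * χ x - c₁ * ψ x := rfl
    rw [hηd x, hx]
    generalize deriv ε x = ε', deriv χ x = χ', deriv ψ x = ψ', ε x = e, χ x = y, ψ x = z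
    have ht0 : 0 ≤ D * (1 - T x ^ 2) := mul_nonneg hD0.le (by linarith [hT1 x])
    have ht1 : D * (1 - T x ^ 2) ≤ D := by nlinarith [sq_nonneg (T x)]
    generalize D * (1 - T x ^ 2) = V at ht0 ht1
    have p1 := perturbed_square_nonneg (s := s) (k := 1 - s / 4) (M := M) (C := C₀)
      (ε' - c₀ * χ' - c₁ * ψ') (c₀ * χ' + c₁ * ψ') hs
      (abs_le.2 ⟨by linarith, by linarith⟩) le_rfl
    have p2 := perturbed_square_nonneg (s := s) (k := 1 - V - s / 4) (M := M) (C := C₀)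
      (e - c₀ * y - c₁ * z) (c₀ * y + c₁ * z) hs
      (abs_le.2 ⟨by linarith, by linarith⟩) le_rfl
    have p3 := mul_nonneg hC₀0.le (sq_nonneg (c₀ * χ' - c₁ * ψ'))
    have p4 := mul_nonneg hC₀0.le (sq_nonneg (c₀ * y - c₁ * z))
    linarith
  have hfin := horth.trans hmono
  rw [integral_add' ((hi0.sub (hiε.const_mul (s / 4))).add (hiχ.const_mul (2 * C₀ * c₀ ^ 2)))
      (hiψ.const_mul (2 * C₀ * c₁ ^ 2)),
    integral_add' (hi0.sub (hiε.const_mul (s / 4))) (hiχ.const_mul (2 * C₀ * c₀ ^ 2)),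
    integral_sub' hi0 (hiε.const_mul (s / 4)), integral_const_mul, integral_const_mul,
    integral_const_mul, ← hA₀, ← hA₁] at hfin
  have r0 : 0 ≤ A₀ / α ^ 2 * e₁ ^ 2 := by positivity
  have r1 : 0 ≤ A₁ / β ^ 2 * e₀ ^ 2 := by positivity
  have r2 : 2 * C₀ * c₀ ^ 2 * A₀ = 2 * C₀ * (A₀ / α ^ 2 * e₀ ^ 2) := by rw [hc₀]; ring
  have r3 : 2 * C₀ * c₁ ^ 2 * A₁ = 2 * C₀ * (A₁ / β ^ 2 * e₁ ^ 2) := by rw [hc₁]; ring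
  nlinarith [mul_nonneg hC₀0.le r0, mul_nonneg hC₀0.le r1, sq_nonneg e₀, sq_nonneg e₁]

theorem exists_cutoff : ∃ (χ : ℕ → ℝ → ℝ) (M : ℝ), 0 ≤ M ∧ (∀ n, ContDiff ℝ 1 (χ n)) ∧
    (∀ n, HasCompactSupport (χ n)) ∧ (∀ n x, |χ n x| ≤ 1) ∧ (∀ n x, |deriv (χ n) x| ≤ M) ∧
    (∀ x, Filter.Tendsto (fun n => χ n x) Filter.atTop (nhds 1)) ∧
    ∀ x, Filter.Tendsto (fun n => deriv (χ n) x) Filter.atTop (nhds 0) := by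
  let B : ContDiffBump (0 : ℝ) := ⟨1, 2, one_pos, one_lt_two⟩
  set χ : ℝ → ℝ := ⇑B
  have hχC : ContDiff ℝ 1 χ := B.contDiff
  have hχs : HasCompactSupport χ := B.hasCompactSupport
  obtain ⟨M, hM⟩ := hχs.deriv.exists_bound_of_continuous (hχC.continuous_deriv le_rfl)
  have hM0 : 0 ≤ M := (norm_nonneg _).trans (hM 0)
  have hd : ∀ (n : ℕ) (x : ℝ), HasDerivAt (fun x => χ (((n : ℝ) + 1)⁻¹ * x))
      (deriv χ (((n : ℝ) + 1)⁻¹ * x) * ((n : ℝ) + 1)⁻¹) x := fun n x => by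
    have h1 : HasDerivAt (fun x : ℝ => ((n : ℝ) + 1)⁻¹ * x) ((n : ℝ) + 1)⁻¹ x := by
      simpa using (hasDerivAt_id x).const_mul ((n : ℝ) + 1)⁻¹
    exact (hχC.differentiable one_ne_zero _).hasDerivAt.comp x h1
  have hbd : ∀ (n : ℕ) (x : ℝ), |deriv χ (((n : ℝ) + 1)⁻¹ * x) * ((n : ℝ) + 1)⁻¹|
      ≤ M * ((n : ℝ) + 1)⁻¹ := fun n x => by
    rw [abs_mul, abs_of_pos (a := ((n : ℝ) + 1)⁻¹) (by positivity)]
    exact mul_le_mul_of_nonneg_right (hM _) (by positivity)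
  have hlim : Filter.Tendsto (fun n : ℕ => ((n : ℝ) + 1)⁻¹) Filter.atTop (nhds 0) := by
    simpa [one_div] using tendsto_one_div_add_atTop_nhds_zero_nat (𝕜 := ℝ)
  refine ⟨fun n x => χ (((n : ℝ) + 1)⁻¹ * x), M, hM0,
    fun n => hχC.comp (contDiff_const.mul contDiff_id), fun n => ?_, fun n x => ?_, fun n x => ?_,
    fun x => ?_, fun x => ?_⟩
  · exact hχs.comp_homeomorph (Homeomorph.mulLeft₀ (((n : ℝ) + 1)⁻¹) (by positivity))
  · rw [abs_of_nonneg B.nonneg]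
    exact B.le_one
  · rw [(hd n x).deriv]
    refine (hbd n x).trans (mul_le_of_le_one_right hM0 (inv_le_one_of_one_le₀ ?_))
    have : (0 : ℝ) ≤ n := n.cast_nonneg
    linarith
  · have h1 : χ 0 = 1 := B.one_of_mem_closedBall (by simp [B])
    have h2 := (hχC.continuous.tendsto 0).comp (by simpa using hlim.mul_const x)
    rwa [h1] at h2
  · refine squeeze_zero_norm (fun n => ?_) (by simpa using hlim.const_mul M)
    rw [(hd n x).deriv]
    exact hbd n x

theorem integrable_mul_of_integrable_sq {f g : ℝ → ℝ} (hf : Continuous f) (hg : Continuous g)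
    (hf2 : Integrable fun x => f x ^ 2) (hg2 : Integrable fun x => g x ^ 2) :
    Integrable fun x => f x * g x := by
  refine (hf2.add hg2).mono' (hf.mul hg).aestronglyMeasurable (Filter.Eventually.of_forall ?_)
  intro x
  rw [Real.norm_eq_abs, Pi.add_apply, abs_le]
  constructor <;> nlinarith [sq_nonneg (f x - g x), sq_nonneg (f x + g x)]

/-- A coercivity estimate on compactly supported `C¹` functions extends to all `C¹` functions
with finite `H¹` norm. -/
theorem coercive_of_coercive_hasCompactSupport {V g h : ℝ → ℝ} {D K C : ℝ}
    (hV : Continuous V) (hVD : ∀ x, |V x| ≤ D) (hg : Continuous g) (hh : Continuous h)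
    (hg2 : Integrable fun x => g x ^ 2) (hh2 : Integrable fun x => h x ^ 2)
    (H : ∀ ε : ℝ → ℝ, ContDiff ℝ 1 ε → HasCompactSupport ε →
      K * (∫ x, (deriv ε x ^ 2 + ε x ^ 2))
          - C * ((∫ x, ε x * g x) ^ 2 + (∫ x, ε x * h x) ^ 2) ≤
        ∫ x, (deriv ε x ^ 2 + V x * ε x ^ 2))
    {ε : ℝ → ℝ} (hε : ContDiff ℝ 1 ε) (hε2 : Integrable fun x => ε x ^ 2)
    (hε'2 : Integrable fun x => deriv ε x ^ 2) :
    K * (∫ x, (deriv ε x ^ 2 + ε x ^ 2))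
        - C * ((∫ x, ε x * g x) ^ 2 + (∫ x, ε x * h x) ^ 2) ≤
      ∫ x, (deriv ε x ^ 2 + V x * ε x ^ 2) := by
  obtain ⟨χ, M, hM, hχC, hχs, hχ1, hχM, hχl, hχl'⟩ := exists_cutoff
  have hεc : Continuous ε := hε.continuous
  have hC : ∀ n, ContDiff ℝ 1 fun x => χ n x * ε x := fun n => (hχC n).mul hε
  have hd : ∀ n x, deriv (fun x => χ n x * ε x) x
      = deriv (χ n) x * ε x + χ n x * deriv ε x := fun n x =>
    (((hχC n).differentiable one_ne_zero x).hasDerivAt.fun_mul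
      (hε.differentiable one_ne_zero x).hasDerivAt).deriv
  have hquad : ∀ {W : ℝ → ℝ} {E : ℝ}, Continuous W → (∀ x, |W x| ≤ E) →
      Filter.Tendsto (fun n => ∫ x, (deriv (fun x => χ n x * ε x) x ^ 2
        + W x * (χ n x * ε x) ^ 2)) Filter.atTop
        (nhds (∫ x, (deriv ε x ^ 2 + W x * ε x ^ 2))) := by
    intro W E hW hWE
    refine tendsto_integral_of_dominated_convergence
      (fun x => 2 * deriv ε x ^ 2 + (2 * M ^ 2 + E) * ε x ^ 2) (fun n => ?_)
      ((hε'2.const_mul 2).add (hε2.const_mul (2 * M ^ 2 + E))) (fun n => ?_) ?_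
    · have := (hC n).continuous_deriv le_rfl
      have := (hC n).continuous
      exact Continuous.aestronglyMeasurable (by fun_prop)
    · refine Filter.Eventually.of_forall fun x => ?_
      have e1 : (χ n x) ^ 2 ≤ 1 := (sq_le_one_iff_abs_le_one _).2 (hχ1 n x)
      have e2 : (deriv (χ n) x) ^ 2 ≤ M ^ 2 :=
        sq_le_sq' (abs_le.1 (hχM n x)).1 (abs_le.1 (hχM n x)).2
      rw [hd]
      have e3 : |W x * (χ n x * ε x) ^ 2| ≤ E * ε x ^ 2 := by
        rw [abs_mul, abs_of_nonneg (sq_nonneg (χ n x * ε x)), mul_pow]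
        exact mul_le_mul (hWE x) (mul_le_of_le_one_left (sq_nonneg _) e1) (by positivity)
          ((abs_nonneg _).trans (hWE x))
      have e4 : (deriv (χ n) x * ε x + χ n x * deriv ε x) ^ 2
          ≤ 2 * deriv ε x ^ 2 + 2 * M ^ 2 * ε x ^ 2 := by
        nlinarith [sq_nonneg (deriv (χ n) x * ε x - χ n x * deriv ε x),
          mul_le_mul_of_nonneg_right e1 (sq_nonneg (deriv ε x)),
          mul_le_mul_of_nonneg_right e2 (sq_nonneg (ε x))]
      calc _ ≤ _ := norm_add_le _ _
        _ ≤ (2 * deriv ε x ^ 2 + 2 * M ^ 2 * ε x ^ 2) + E * ε x ^ 2 := by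
          refine add_le_add ?_ e3
          rwa [Real.norm_eq_abs, abs_of_nonneg (sq_nonneg _)]
        _ = _ := by ring
    · refine Filter.Eventually.of_forall fun x => ?_
      simp only [hd]
      have := ((((hχl' x).mul_const (ε x)).add ((hχl x).mul_const (deriv ε x))).pow 2).add
        ((((hχl x).mul_const (ε x)).pow 2).const_mul (W x))
      simpa using this
  have hlin : ∀ {k : ℝ → ℝ}, Continuous k → (Integrable fun x => k x ^ 2) →
      Filter.Tendsto (fun n => ∫ x, χ n x * ε x * k x) Filter.atTop
        (nhds (∫ x, ε x * k x)) := by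
    intro k hk hk2
    refine tendsto_integral_of_dominated_convergence (fun x => |ε x * k x|) (fun n => ?_)
      (integrable_mul_of_integrable_sq hεc hk hε2 hk2).abs (fun n => ?_) ?_
    · exact ((hC n).continuous.mul hk).aestronglyMeasurable
    · refine Filter.Eventually.of_forall fun x => ?_
      rw [mul_assoc, norm_mul]
      exact mul_le_of_le_one_left (norm_nonneg _) (hχ1 n x)
    · refine Filter.Eventually.of_forall fun x => ?_
      simpa using ((hχl x).mul_const (ε x)).mul_const (k x)
  have hone := hquad (W := fun _ => 1) (E := 1) continuous_const (by simp)
  simp only [one_mul] at hone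
  exact le_of_tendsto_of_tendsto' ((hone.const_mul K).sub
    ((((hlin hg hg2).pow 2).add ((hlin hh hh2).pow 2)).const_mul C)) (hquad hV hVD)
    fun n => H _ (hC n) (hχs n).mul_right

theorem integrable_sq_of_abs_le_exp {f : ℝ → ℝ} {C : ℝ} (hf : Continuous f)
    (hb : ∀ x, |f x| ≤ C * Real.exp (-|x|)) : Integrable fun x => f x ^ 2 := by
  refine (integrable_inv_one_add_sq.const_mul (C ^ 2)).mono' (hf.pow 2).aestronglyMeasurable
    (Filter.Eventually.of_forall fun x => ?_)
  rw [Real.norm_eq_abs, abs_of_nonneg (sq_nonneg _), ← sq_abs (f x)]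
  calc |f x| ^ 2 ≤ (C * Real.exp (-|x|)) ^ 2 := pow_le_pow_left₀ (abs_nonneg _) (hb x) 2
    _ = C ^ 2 * (Real.exp |x| ^ 2)⁻¹ := by rw [Real.exp_neg]; ring
    _ ≤ C ^ 2 * (1 + x ^ 2)⁻¹ := by
      have h1 : |x| + 1 ≤ Real.exp |x| := Real.add_one_le_exp _
      have h2 : 1 + x ^ 2 ≤ Real.exp |x| ^ 2 := by
        nlinarith [abs_nonneg x, sq_abs x]
      gcongr

theorem hasDerivAt_tanh_mul (a x : ℝ) :
    HasDerivAt (fun x => Real.tanh (a * x)) (a * (1 - Real.tanh (a * x) ^ 2)) x := by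
  have hc := (Real.cosh_pos (a * x)).ne'
  have hl : HasDerivAt (fun x : ℝ => a * x) a x := by
    simpa using (hasDerivAt_id x).const_mul a
  simp only [Real.tanh_eq_sinh_div_cosh]
  refine ((hl.sinh).fun_div hl.cosh hc).congr_deriv ?_
  field_simp

theorem Q_pos (p : ℕ) (x : ℝ) : 0 < Q p x := by
  have := Real.cosh_pos (((p : ℝ) - 1) / 2 * x)
  unfold Q
  positivity

theorem Q_eq (p : ℕ) (x : ℝ) : Q p x =
    (((p : ℝ) + 1) / 2 * (1 - Real.tanh (((p : ℝ) - 1) / 2 * x) ^ 2)) ^ (1 / ((p : ℝ) - 1)) := by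
  have hc := (Real.cosh_pos (((p : ℝ) - 1) / 2 * x)).ne'
  unfold Q
  congr 1
  rw [Real.tanh_eq_sinh_div_cosh]
  have h := Real.cosh_sq_sub_sinh_sq (((p : ℝ) - 1) / 2 * x)
  generalize ((p : ℝ) - 1) / 2 * x = y at hc h ⊢
  field_simp
  linear_combination -h

theorem Q_pow_sub_one {p : ℕ} (hp : 2 ≤ p) (x : ℝ) : Q p x ^ (p - 1) =
    ((p : ℝ) + 1) / 2 * (1 - Real.tanh (((p : ℝ) - 1) / 2 * x) ^ 2) := by
  have hp' : (2 : ℝ) ≤ p := by exact_mod_cast hp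
  have ht := Real.tanh_sq_lt_one (((p : ℝ) - 1) / 2 * x)
  rw [Q_eq, ← Real.rpow_natCast, ← Real.rpow_mul (by
    exact mul_nonneg (by linarith) (by linarith)), Nat.cast_sub (by omega), Nat.cast_one,
    one_div_mul_cancel (by linarith), Real.rpow_one]

theorem hasDerivAt_Q {p : ℕ} (hp : 2 ≤ p) (x : ℝ) :
    HasDerivAt (Q p) (-(Real.tanh (((p : ℝ) - 1) / 2 * x) * Q p x)) x := by
  have hp' : (2 : ℝ) ≤ p := by exact_mod_cast hp
  have ht := Real.tanh_sq_lt_one (((p : ℝ) - 1) / 2 * x)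
  have hR : 0 < ((p : ℝ) + 1) / 2 * (1 - Real.tanh (((p : ℝ) - 1) / 2 * x) ^ 2) :=
    mul_pos (by linarith) (by linarith)
  have hd := ((((hasDerivAt_tanh_mul (((p : ℝ) - 1) / 2) x).fun_pow 2).const_sub 1).const_mul
    (((p : ℝ) + 1) / 2)).rpow_const (p := 1 / ((p : ℝ) - 1)) (Or.inl hR.ne')
  rw [← funext (Q_eq p)] at hd
  refine hd.congr_deriv ?_
  rw [Real.rpow_sub_one hR.ne', ← Q_eq]
  have h1 : (p : ℝ) - 1 ≠ 0 := by linarith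
  have h2 : (p : ℝ) + 1 ≠ 0 := by linarith
  have h3 : 1 - Real.tanh (((p : ℝ) - 1) / 2 * x) ^ 2 ≠ 0 := by linarith
  generalize Real.tanh (((p : ℝ) - 1) / 2 * x) = t at *
  field_simp
  push_cast
  ring

theorem Q_neg (p : ℕ) (x : ℝ) : Q p (-x) = Q p x := by
  unfold Q
  rw [mul_neg, Real.cosh_neg]

theorem exists_Q_le_exp {p : ℕ} (hp : 2 ≤ p) :
    ∃ C : ℝ, 0 < C ∧ ∀ x, Q p x ≤ C * Real.exp (-|x|) := by
  have hp' : (2 : ℝ) ≤ p := by exact_mod_cast hp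
  refine ⟨(2 * ((p : ℝ) + 1)) ^ (1 / ((p : ℝ) - 1)), by positivity, fun x => ?_⟩
  have h1 : (p : ℝ) - 1 ≠ 0 := by linarith
  have he : Real.exp (-|x|) = Real.exp (-(((p : ℝ) - 1) * |x|)) ^ (1 / ((p : ℝ) - 1)) := by
    rw [← Real.exp_mul]
    congr 1
    field_simp
  rw [he, ← Real.mul_rpow (by positivity) (by positivity)]
  unfold Q
  have hc : Real.exp (((p : ℝ) - 1) * |x|) / 4 ≤ Real.cosh (((p : ℝ) - 1) / 2 * x) ^ 2 := by
    have h2 : Real.exp (((p : ℝ) - 1) / 2 * |x|) / 2 ≤ Real.cosh (((p : ℝ) - 1) / 2 * x) := by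
      rw [← Real.cosh_abs, abs_mul, abs_of_nonneg (by linarith : 0 ≤ ((p : ℝ) - 1) / 2),
        Real.cosh_eq]
      have := Real.exp_pos (-(((p : ℝ) - 1) / 2 * |x|))
      linarith
    have h3 : Real.exp (((p : ℝ) - 1) * |x|) = Real.exp (((p : ℝ) - 1) / 2 * |x|) ^ 2 := by
      rw [← Real.exp_nat_mul]
      congr 1
      push_cast
      ring
    rw [h3]
    calc _ = (Real.exp (((p : ℝ) - 1) / 2 * |x|) / 2) ^ 2 := by ring
      _ ≤ _ := pow_le_pow_left₀ (by positivity) h2 2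
  have hc0 := Real.cosh_pos (((p : ℝ) - 1) / 2 * x)
  refine Real.rpow_le_rpow (by positivity) ?_ (one_div_nonneg.2 (by linarith))
  rw [Real.exp_neg]
  calc ((p : ℝ) + 1) / (2 * Real.cosh (((p : ℝ) - 1) / 2 * x) ^ 2)
      ≤ ((p : ℝ) + 1) / (2 * (Real.exp (((p : ℝ) - 1) * |x|) / 4)) := by gcongr
    _ = _ := by
      have := (Real.exp_pos (((p : ℝ) - 1) * |x|)).ne'
      field_simp
      ring

theorem exists_Q_rpow_le_exp {p : ℕ} (hp : 2 ≤ p) {r : ℝ} (hr : 1 ≤ r) :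
    ∃ C : ℝ, ∀ x, Q p x ^ r ≤ C * Real.exp (-|x|) := by
  obtain ⟨C, hC, h⟩ := exists_Q_le_exp hp
  refine ⟨C ^ r, fun x => ?_⟩
  calc Q p x ^ r ≤ (C * Real.exp (-|x|)) ^ r :=
        Real.rpow_le_rpow (Q_pos p x).le (h x) (by linarith)
    _ = C ^ r * Real.exp (-|x| * r) := by
        rw [Real.mul_rpow hC.le (Real.exp_pos _).le, Real.exp_mul]
    _ ≤ _ := by
        gcongr
        nlinarith [abs_nonneg x]

/-- Coercivity of `(Lε,ε)` with respect to the `H¹` norm, up to the component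
along `Q^((p+1)/2)`, under orthogonality to `Q'`. -/
theorem stmt12 (p : ℕ) (hp : 2 ≤ p) :
    ∃ K₁ K₂ : ℝ, 0 < K₁ ∧ 0 < K₂ ∧ ∀ ε : ℝ → ℝ, ContDiff ℝ 1 ε →
      Integrable (fun x : ℝ => ε x ^ 2) → Integrable (fun x : ℝ => deriv ε x ^ 2) →
      (∫ x : ℝ, ε x * deriv (Q p) x) = 0 →
      K₁ * ((∫ x : ℝ, ε x ^ 2) + (∫ x : ℝ, deriv ε x ^ 2))
          - K₂ * (∫ x : ℝ, ε x * Q p x ^ (((p : ℝ) + 1) / 2)) ^ 2 ≤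
        (∫ x : ℝ, deriv ε x ^ 2) + (∫ x : ℝ, ε x ^ 2)
          - (p : ℝ) * ∫ x : ℝ, Q p x ^ (p - 1) * ε x ^ 2 := by
  have hp' : (2 : ℝ) ≤ p := by exact_mod_cast hp
  set a : ℝ := ((p : ℝ) - 1) / 2 with ha
  have hpa : (p : ℝ) = 2 * a + 1 := by rw [ha]; ring
  have hpa' : ((p : ℝ) + 1) / 2 = 1 + a := by rw [ha]; ring
  have ha2 : 1 / 2 ≤ a := by linarith
  set T : ℝ → ℝ := fun x => Real.tanh (a * x) with hT
  set G : ℝ → ℝ := fun x => Q p x ^ (((p : ℝ) + 1) / 2) with hG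
  have hdT : ∀ x, HasDerivAt T (a * (1 - T x ^ 2)) x := hasDerivAt_tanh_mul a
  have hT1 : ∀ x, T x ^ 2 ≤ 1 := fun x => (Real.tanh_sq_lt_one _).le
  have hdQ : ∀ x, HasDerivAt (Q p) (-(T x * Q p x)) x := hasDerivAt_Q hp
  have hG0 : ∀ x, 0 < G x := fun x => Real.rpow_pos_of_pos (Q_pos p x) _
  have hdG : ∀ x, HasDerivAt G (-((1 + a) * T x * G x)) x := fun x => by
    refine ((hdQ x).rpow_const (p := ((p : ℝ) + 1) / 2) (Or.inl (Q_pos p x).ne')).congr_deriv ?_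
    rw [Real.rpow_sub_one (Q_pos p x).ne', hpa']
    have := (Q_pos p x).ne'
    simp only [hG, hpa']
    field_simp
  have hTc : Continuous T := continuous_iff_continuousAt.2 fun x => (hdT x).continuousAt
  have hQc : Continuous (Q p) := continuous_iff_continuousAt.2 fun x => (hdQ x).continuousAt
  have hGc : Continuous G := continuous_iff_continuousAt.2 fun x => (hdG x).continuousAt
  have hT0 : T 1 ≠ 0 := by
    have h := Real.sinh_pos_iff.2 (show 0 < a * 1 by linarith)
    simp only [hT, Real.tanh_eq_sinh_div_cosh]
    exact (div_pos h (Real.cosh_pos _)).ne'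
  obtain ⟨K, C, hK, hC, H⟩ := exists_coercive_of_hasCompactSupport ha2 hdT hT1 (Q_pos p) hdQ hG0
    hdG (fun x => by simp [hT]) (Q_neg p) (fun x => by simp only [hG, Q_neg]) hT0
  refine ⟨K, C, hK, hC, fun ε hε hε2 hε'2 horth => ?_⟩
  have hG2 : Integrable fun x => G x ^ 2 := by
    obtain ⟨c, hc⟩ := exists_Q_rpow_le_exp hp (r := ((p : ℝ) + 1) / 2) (by linarith)
    exact integrable_sq_of_abs_le_exp hGc fun x => by
      rw [abs_of_pos (hG0 x)]
      exact hc x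
  have hTQ2 : Integrable fun x => (T x * Q p x) ^ 2 := by
    obtain ⟨c, -, hc⟩ := exists_Q_le_exp hp
    refine integrable_sq_of_abs_le_exp (C := c) (hTc.mul hQc) fun x => ?_
    rw [abs_mul, abs_of_pos (Q_pos p x)]
    exact (mul_le_of_le_one_left (Q_pos p x).le
      ((sq_le_one_iff_abs_le_one _).1 (hT1 x))).trans (hc x)
  have hD : 0 ≤ (2 * a + 1) * (a + 1) := by
    have : 0 ≤ a := by linarith
    positivity
  have hfin := coercive_of_coercive_hasCompactSupport
    (V := fun x => 1 - (2 * a + 1) * (a + 1) * (1 - T x ^ 2)) (D := 1 + (2 * a + 1) * (a + 1))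
    (by fun_prop) (fun x => by
      have h1 := mul_nonneg hD (sub_nonneg.2 (hT1 x))
      have h2 := mul_nonneg hD (sq_nonneg (T x))
      exact abs_le.2 ⟨by linarith, by linarith⟩)
    hGc (h := fun x => T x * Q p x) (hTc.mul hQc) hG2 hTQ2 H hε hε2 hε'2
  have horth' : ∫ x, ε x * (T x * Q p x) = 0 := by
    simp only [(hdQ _).deriv, mul_neg, integral_neg, neg_eq_zero] at horth
    exact horth
  have hpot : ∀ x, (p : ℝ) * (Q p x ^ (p - 1) * ε x ^ 2)
      = (2 * a + 1) * (a + 1) * (1 - T x ^ 2) * ε x ^ 2 := fun x => by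
    have hQ : Q p x ^ (p - 1) = (1 + a) * (1 - T x ^ 2) := by rw [← hpa', Q_pow_sub_one hp]
    rw [hQ, hpa]
    ring
  have hi : Integrable fun x => (2 * a + 1) * (a + 1) * (1 - T x ^ 2) * ε x ^ 2 := by
    refine (hε2.const_mul ((2 * a + 1) * (a + 1))).mono'
      (Continuous.aestronglyMeasurable (by have := hε.continuous; fun_prop))
      (Filter.Eventually.of_forall fun x => ?_)
    have h1 := mul_nonneg hD (sub_nonneg.2 (hT1 x))
    rw [Real.norm_eq_abs, abs_of_nonneg (mul_nonneg h1 (sq_nonneg _))]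
    have h2 := mul_nonneg hD (sq_nonneg (T x))
    exact mul_le_mul_of_nonneg_right (by linarith) (sq_nonneg _)
  have hsplit : ∫ x, (deriv ε x ^ 2 + (1 - (2 * a + 1) * (a + 1) * (1 - T x ^ 2)) * ε x ^ 2)
      = (∫ x, deriv ε x ^ 2) + (∫ x, ε x ^ 2) - (p : ℝ) * ∫ x, Q p x ^ (p - 1) * ε x ^ 2 := by
    have hs : Integrable fun x => deriv ε x ^ 2 + ε x ^ 2 := hε'2.add hε2
    rw [← integral_const_mul, ← integral_add hε'2 hε2]
    simp only [hpot]
    rw [← integral_sub hs hi]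
    congr 1 with x
    ring
  rw [hsplit, integral_add hε'2 hε2, horth'] at hfin
  linarith
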